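/- arXiv:math/0405166 — 6 statements merged into one kernel-verified Lean document; each statement's English description precedes it below -/
import Mathlib

section
/- Let O ⊆ ℝ^N be open and let v : O → ℝ be a lower semicontinuous viscosity supersolution of the constrained Hamilton–Jacobi–Bellman inequality on O. Let φ : ℝ → ℝ be twice continuously differentiable with φ'(t) > 0 for every t ∈ ℝ. Then w := φ ∘ v is again a lower semicontinuous viscosity supersolution of the constrained Hamilton–Jacobi–Bellman inequality on O. -/
open Matrix Filter Topology

/-- `(p, Y)` belongs to the second-order subjet `J^{2,-} V (x)` of `V : O → ℝ`:
`Y` is symmetric and `V y ≥ V x + p·(y-x) + ½ (y-x)·Y(y-x) + o(|y-x|²)` as `y → x` in `O`. -/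
def InSubjet {d : ℕ} (O : Set (Fin d → ℝ)) (V : (Fin d → ℝ) → ℝ)
    (x p : Fin d → ℝ) (Y : Matrix (Fin d) (Fin d) ℝ) : Prop :=
  Y.IsSymm ∧ ∀ ε > (0 : ℝ), ∃ δ > (0 : ℝ), ∀ y ∈ O, ‖y - x‖ ≤ δ →
    V y ≥ V x + p ⬝ᵥ (y - x) + (1 / 2) * ((y - x) ⬝ᵥ Y *ᵥ (y - x)) - ε * ‖y - x‖ ^ 2

/-- `V` is a viscosity supersolution on `O` of the constrained Hamilton–Jacobi–Bellman
inequality `sup_{α ∈ A, σ(x,α)ᵀ DV = 0} { -DV·f(x,α) - trace[a(x,α) D²V] } ≥ 0`,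
where `a := (1/2) σ σᵀ`. -/
def IsSupersolution {N M : ℕ} {A : Type*}
    (f : (Fin N → ℝ) → A → (Fin N → ℝ))
    (σ : (Fin N → ℝ) → A → Matrix (Fin N) (Fin M) ℝ)
    (O : Set (Fin N → ℝ)) (V : (Fin N → ℝ) → ℝ) : Prop :=
  ∀ x ∈ O, ∀ p Y, InSubjet O V x p Y → ∃ α : A,
    (σ x α)ᵀ *ᵥ p = 0 ∧
    0 ≤ -(p ⬝ᵥ f x α) - trace ((((1 : ℝ) / 2) • (σ x α * (σ x α)ᵀ)) * Y)


theorem aux_taylor (φ : ℝ → ℝ) (hφ : ContDiff ℝ 2 φ) (t : ℝ) :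
    ∃ b : ℝ, ∀ η > (0 : ℝ), ∃ δ > (0 : ℝ), ∀ s : ℝ, |s| ≤ δ →
      φ (t + s) ≤ φ t + deriv φ t * s + b / 2 * s ^ 2 + η * s ^ 2 := by
  have h := taylor_isLittleO_univ (f := φ) (x₀ := t) (n := 2) hφ
  refine ⟨iteratedDeriv 2 φ t, fun η hη => ?_⟩
  have h2 := h.def hη
  rw [Metric.eventually_nhds_iff] at h2
  obtain ⟨δ, hδ, h2⟩ := h2
  refine ⟨δ / 2, by positivity, fun s hs => ?_⟩
  have h3 := @h2 (t + s) (by rw [Real.dist_eq]; simp only [add_sub_cancel_left]; linarith)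
  simp only [taylorWithinEval_succ, taylor_within_zero_eval, Real.norm_eq_abs, iteratedDerivWithin_one,
    derivWithin_univ, add_sub_cancel_left, smul_eq_mul, abs_pow, sq_abs, zero_add] at h3
  have h4 := le_of_abs_le h3
  norm_num at h4
  linarith

theorem aux_dot {N : ℕ} (u w : Fin N → ℝ) : |u ⬝ᵥ w| ≤ N * ‖u‖ * ‖w‖ := by
  unfold dotProduct
  calc |∑ i, u i * w i| ≤ ∑ i, |u i * w i| := Finset.abs_sum_le_sum_abs _ _
    _ ≤ ∑ _i : Fin N, ‖u‖ * ‖w‖ := by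
        apply Finset.sum_le_sum
        intro i _
        rw [abs_mul]
        exact mul_le_mul (norm_le_pi_norm u i) (norm_le_pi_norm w i) (abs_nonneg _) (norm_nonneg _)
    _ = N * ‖u‖ * ‖w‖ := by simp [mul_assoc]

theorem aux_quad {N : ℕ} (Z : Matrix (Fin N) (Fin N) ℝ) :
    ∃ K : ℝ, 0 ≤ K ∧ ∀ h : Fin N → ℝ, |h ⬝ᵥ Z *ᵥ h| ≤ K * ‖h‖ ^ 2 := by
  let L := LinearMap.toContinuousLinearMap (Matrix.mulVecLin Z)
  refine ⟨N * ‖L‖, by positivity, fun h => ?_⟩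
  have h1 : ‖Z *ᵥ h‖ ≤ ‖L‖ * ‖h‖ := L.le_opNorm h
  calc _ ≤ N * ‖h‖ * ‖Z *ᵥ h‖ := aux_dot _ _
    _ ≤ N * ‖h‖ * (‖L‖ * ‖h‖) := by gcongr
    _ = _ := by ring

theorem aux_arith (b c ε K1 K3 A B r η : ℝ) (hc : 0 < c) (hε : 0 < ε)
    (hK1 : 0 ≤ K1) (hK3 : 0 ≤ K3) (hr : 0 ≤ r) (hr1 : r ≤ 1)
    (hA : |A| ≤ K1 * r) (hB : |B| ≤ K3 * r ^ 2) (hη0 : 0 ≤ η)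
    (hη : η * (K1 + K3) ^ 2 ≤ c * ε / 4)
    (hr2 : |b| / 2 * (K3 * (2 * K1 + K3)) * r ≤ c * ε / 4) :
    b / 2 * (A + B) ^ 2 + η * (A + B) ^ 2 ≤ b / 2 * A ^ 2 + c * ε / 2 * r ^ 2 := by
  have hrr : r ^ 2 ≤ r := by nlinarith
  have hB' : |B| ≤ K3 * r := hB.trans (by gcongr)
  have hs : (A + B) ^ 2 ≤ (K1 + K3) ^ 2 * r ^ 2 := by
    rw [← mul_pow, ← sq_abs (A + B)]
    have := abs_add_le A B
    gcongr
    linarith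
  have h1 : η * (A + B) ^ 2 ≤ c * ε / 4 * r ^ 2 :=
    calc _ ≤ η * ((K1 + K3) ^ 2 * r ^ 2) := by gcongr
      _ = η * (K1 + K3) ^ 2 * r ^ 2 := by ring
      _ ≤ _ := by gcongr
  have h2 : |2 * A + B| ≤ (2 * K1 + K3) * r := by
    have := abs_add_le (2 * A) B
    rw [abs_mul, abs_two] at this
    linarith
  have h3 : b / 2 * (B * (2 * A + B)) ≤ c * ε / 4 * r ^ 2 :=
    calc _ ≤ |b / 2 * (B * (2 * A + B))| := le_abs_self _
      _ = |b| / 2 * (|B| * |2 * A + B|) := by rw [abs_mul, abs_mul, abs_div, abs_two]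
      _ ≤ |b| / 2 * ((K3 * r ^ 2) * ((2 * K1 + K3) * r)) := by gcongr
      _ = |b| / 2 * (K3 * (2 * K1 + K3)) * r * r ^ 2 := by ring
      _ ≤ _ := by gcongr
  linarith [h1, h3]

set_option maxHeartbeats 1000000 in
theorem aux_subjet {N : ℕ} (O : Set (Fin N → ℝ)) (v : (Fin N → ℝ) → ℝ)
    (φ : ℝ → ℝ) (hφ : ContDiff ℝ 2 φ) (hφ' : ∀ t : ℝ, 0 < deriv φ t)
    (x p : Fin N → ℝ) (Y : Matrix (Fin N) (Fin N) ℝ) (h : InSubjet O (φ ∘ v) x p Y) :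
    ∃ b : ℝ, InSubjet O v x ((deriv φ (v x))⁻¹ • p)
      ((deriv φ (v x))⁻¹ • (Y - b • vecMulVec p p)) := by
  obtain ⟨β, hT⟩ := aux_taylor φ hφ (v x)
  have hmono : StrictMono φ := strictMono_of_deriv_pos hφ'
  have hc := hφ' (v x)
  set c := deriv φ (v x) with hcdef
  set b := β * c⁻¹ ^ 2 with hb
  refine ⟨b, ?_, fun ε hε => ?_⟩
  · have := h.1
    unfold Matrix.IsSymm at *
    rw [transpose_smul, transpose_sub, transpose_smul, transpose_vecMulVec, this]
  obtain ⟨K2, hK2, hq⟩ := aux_quad (c⁻¹ • (Y - b • vecMulVec p p))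
  set Z := c⁻¹ • (Y - b • vecMulVec p p) with hZ
  set K1 : ℝ := N * ‖c⁻¹ • p‖ with hK1d
  have hK1 : 0 ≤ K1 := by positivity
  set K3 : ℝ := K2 / 2 + ε with hK3d
  have hK3 : 0 < K3 := by positivity
  set η := c * ε / 4 / (K1 + K3) ^ 2 with hηd
  have hη : 0 < η := by positivity
  obtain ⟨δ1, hδ1, hT⟩ := hT η hη
  obtain ⟨δ2, hδ2, hS⟩ := h.2 (c * ε / 4) (by positivity)
  set D := |β| / 2 * (K3 * (2 * K1 + K3)) with hD
  have hD0 : 0 ≤ D := by positivity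
  refine ⟨min (min 1 δ2) (min (δ1 / (K1 + K3)) (c * ε / 4 / (D + 1))), by positivity, ?_⟩
  intro y hy hyd
  rw [le_min_iff, le_min_iff, le_min_iff] at hyd
  obtain ⟨⟨hr1, hr2⟩, hr3, hr4⟩ := hyd
  have hS := hS y hy hr2
  have hqy := hq (y - x)
  have hAy : |(c⁻¹ • p) ⬝ᵥ (y - x)| ≤ K1 * ‖y - x‖ := aux_dot _ _
  have hr : 0 ≤ ‖y - x‖ := norm_nonneg _
  have hexp : c * ((y - x) ⬝ᵥ Z *ᵥ (y - x)) =
      (y - x) ⬝ᵥ Y *ᵥ (y - x) - β * ((c⁻¹ • p) ⬝ᵥ (y - x)) ^ 2 := by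
    rw [hZ, hb]
    generalize y - x = h
    simp only [smul_mulVec, sub_mulVec, vecMulVec_mulVec, dotProduct_smul, dotProduct_sub,
      smul_dotProduct, smul_eq_mul, op_smul_eq_smul]
    rw [dotProduct_comm h p]
    field_simp
  have hexp1 : c * ((c⁻¹ • p) ⬝ᵥ (y - x)) = p ⬝ᵥ (y - x) := by
    rw [smul_dotProduct, smul_eq_mul]
    field_simp
  simp only [Function.comp] at hS
  generalize (y - x) ⬝ᵥ Z *ᵥ (y - x) = QZ at *
  generalize (y - x) ⬝ᵥ Y *ᵥ (y - x) = QY at *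
  generalize (c⁻¹ • p) ⬝ᵥ (y - x) = A at *
  generalize p ⬝ᵥ (y - x) = P at *
  generalize ‖y - x‖ = r at *
  have hB : |1 / 2 * QZ - ε * r ^ 2| ≤ K3 * r ^ 2 := by
    rw [abs_le] at hqy ⊢
    have := sq_nonneg r
    constructor <;> rw [hK3d] <;> nlinarith
  have hrr : r ^ 2 ≤ r := by nlinarith
  have hs : |A + (1 / 2 * QZ - ε * r ^ 2)| ≤ δ1 := by
    rw [le_div_iff₀ (by positivity)] at hr3
    have h1 := abs_add_le A (1 / 2 * QZ - ε * r ^ 2)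
    have h2 : K3 * r ^ 2 ≤ K3 * r := by gcongr
    linarith
  have hT := hT _ hs
  have har := aux_arith β c ε K1 K3 A (1 / 2 * QZ - ε * r ^ 2) r η hc hε hK1 hK3.le hr hr1 hAy hB
    hη.le (by rw [hηd]; field_simp; rfl) (by
      rw [le_div_iff₀ (by positivity)] at hr4
      rw [← hD]; nlinarith)
  by_contra hcon
  have hlt : v y < v x + (A + (1 / 2 * QZ - ε * r ^ 2)) := by
    have := not_le.mp hcon
    linarith
  have := hmono hlt
  have hce : 0 ≤ c * ε * r ^ 2 := by positivity
  have e : c * (A + (1 / 2 * QZ - ε * r ^ 2)) = P + 1 / 2 * (QY - β * A ^ 2) - c * ε * r ^ 2 := by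
    rw [← hexp, ← hexp1]; ring
  linarith

/-- If `v` is a lower semicontinuous viscosity supersolution of the constrained HJB
inequality on an open set `O` and `φ : ℝ → ℝ` is `C²` with `φ' > 0` everywhere, then
`w = φ ∘ v` is again a lower semicontinuous viscosity supersolution on `O`. -/
theorem change_of_unknown_supersolution
    {N M : ℕ} (hN : 0 < N) (hM : 0 < M)
    {A : Type*} [MetricSpace A] [CompactSpace A]
    (f : (Fin N → ℝ) → A → (Fin N → ℝ))
    (σ : (Fin N → ℝ) → A → Matrix (Fin N) (Fin M) ℝ)
    (hf : Continuous fun q : (Fin N → ℝ) × A => f q.1 q.2)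
    (hσ : Continuous fun q : (Fin N → ℝ) × A => σ q.1 q.2)
    (O : Set (Fin N → ℝ)) (hO : IsOpen O)
    (v : (Fin N → ℝ) → ℝ)
    (hv : LowerSemicontinuousOn v O)
    (hsuper : IsSupersolution f σ O v)
    (φ : ℝ → ℝ) (hφ : ContDiff ℝ 2 φ) (hφ' : ∀ t : ℝ, 0 < deriv φ t) :
    LowerSemicontinuousOn (φ ∘ v) O ∧ IsSupersolution f σ O (φ ∘ v) := by
  have hmono : StrictMono φ := strictMono_of_deriv_pos hφ'
  refine ⟨?_, ?_⟩
  · exact hφ.continuous.comp_lowerSemicontinuousOn hv hmono.monotone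
  intro x hx p Y hpY
  obtain ⟨b, hb⟩ := aux_subjet O v φ hφ hφ' x p Y hpY
  obtain ⟨α, h1, h2⟩ := hsuper x hx _ _ hb
  have hc := hφ' (v x)
  rw [mulVec_smul, smul_eq_zero] at h1
  have h1 := h1.resolve_left (by positivity)
  refine ⟨α, h1, ?_⟩
  have h3 : (σ x α * (σ x α)ᵀ) * vecMulVec p p = 0 := by
    rw [Matrix.mul_assoc, mul_vecMulVec, h1, zero_vecMulVec, Matrix.mul_zero]
  simp only [Matrix.mul_smul, Matrix.smul_mul, Matrix.mul_sub, h3, smul_zero, sub_zero,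
    trace_smul, smul_dotProduct, smul_eq_mul] at h2 ⊢
  have h4 := mul_nonneg hc.le h2
  field_simp at h4 ⊢
  linarith
end

section
/- Let O ⊆ ℝ^N be open, let A be nonempty, let V : O → ℝ be lower semicontinuous, and let μ̄ ∈ ℝ. Assume that for every μ ≤ μ̄ the sublevel set K_μ := {x ∈ O : V(x) ≤ μ} is a closed subset of ℝ^N with topological boundary ∂K_μ contained in O, and that for every x ∈ ∂K_μ and every (p,Y) ∈ 𝒩²_{K_μ}(x) there exists α ∈ A with σ(x,α)ᵀp = 0 and f(x,α)·p + trace[a(x,α)Y] ≥ 0. Then the function V̄(x) := min(V(x), μ̄) is a viscosity supersolution of the constrained Hamilton–Jacobi–Bellman inequality on O. -/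
open Matrix Filter Topology

/-- `(p, Y)` belongs to the second-order normal cone `𝒩²_K(x)`:
`Y` is symmetric and `p·(y-x) + ½ (y-x)·Y(y-x) ≥ o(|y-x|²)` as `y → x`, `y ∈ K`. -/
def InNormalCone {d : ℕ} (K : Set (Fin d → ℝ))
    (x p : Fin d → ℝ) (Y : Matrix (Fin d) (Fin d) ℝ) : Prop :=
  Y.IsSymm ∧ ∀ ε > (0 : ℝ), ∃ δ > (0 : ℝ), ∀ y ∈ K, ‖y - x‖ ≤ δ →
    p ⬝ᵥ (y - x) + (1 / 2) * ((y - x) ⬝ᵥ Y *ᵥ (y - x)) ≥ -ε * ‖y - x‖ ^ 2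

theorem aux_max {N : ℕ} (p : Fin N → ℝ) (Y : Matrix (Fin N) (Fin N) ℝ)
    (h : ∀ ε > (0 : ℝ), ∃ δ > (0 : ℝ), ∀ v : Fin N → ℝ, ‖v‖ ≤ δ →
      p ⬝ᵥ v + (1 / 2) * (v ⬝ᵥ Y *ᵥ v) ≤ ε * ‖v‖ ^ 2) :
    p = 0 ∧ ∀ v : Fin N → ℝ, v ⬝ᵥ Y *ᵥ v ≤ 0 := by
  have key : ∀ v : Fin N → ℝ, ∀ ε > (0 : ℝ), ∃ δ > (0 : ℝ), ∀ t : ℝ, |t| ≤ δ →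
      t * (p ⬝ᵥ v) + (1 / 2) * (t ^ 2 * (v ⬝ᵥ Y *ᵥ v)) ≤ ε * (t ^ 2 * ‖v‖ ^ 2) := by
    intro v ε hε
    obtain ⟨δ, hδ, H⟩ := h ε hε
    have hv : 0 < ‖v‖ + 1 := by positivity
    refine ⟨δ / (‖v‖ + 1), by positivity, fun t ht => ?_⟩
    have h1 : ‖t • v‖ ≤ δ := by
      rw [norm_smul, Real.norm_eq_abs]
      rw [le_div_iff₀ hv] at ht
      nlinarith [abs_nonneg t]
    have h2 := H (t • v) h1
    rw [norm_smul, Real.norm_eq_abs, mul_pow, sq_abs] at h2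
    simp only [mulVec_smul, dotProduct_smul, smul_dotProduct, smul_eq_mul] at h2
    nlinarith [h2]
  constructor
  · by_contra hp
    have hpp : 0 < p ⬝ᵥ p := by
      have h0 : 0 ≤ p ⬝ᵥ p := Finset.sum_nonneg fun i _ => mul_self_nonneg (p i)
      exact lt_of_le_of_ne h0 fun e => hp (dotProduct_self_eq_zero.1 e.symm)
    obtain ⟨δ, hδ, H⟩ := key p 1 one_pos
    set q := p ⬝ᵥ Y *ᵥ p
    set c := |‖p‖ ^ 2 - q / 2| + 1 with hc
    have hcp : 0 < c := by positivity
    have hcl : ‖p‖ ^ 2 - q / 2 < c := by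
      have := le_abs_self (‖p‖ ^ 2 - q / 2)
      linarith
    set t := min δ (p ⬝ᵥ p / c) with ht
    have htp : 0 < t := lt_min hδ (by positivity)
    have h1 := H t (by rw [abs_of_pos htp]; exact min_le_left _ _)
    have h2 : t * c ≤ p ⬝ᵥ p := (le_div_iff₀ hcp).1 (min_le_right _ _)
    have h3 : t * (t * c) ≤ t * (p ⬝ᵥ p) := mul_le_mul_of_nonneg_left h2 htp.le
    have h4 : t ^ 2 * (‖p‖ ^ 2 - q / 2) < t ^ 2 * c :=
      mul_lt_mul_of_pos_left hcl (by positivity)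
    nlinarith
  · intro v
    by_contra hv
    push Not at hv
    have hd : 0 < 4 * (‖v‖ ^ 2 + 1) := by positivity
    obtain ⟨δ, hδ, H⟩ := key v ((v ⬝ᵥ Y *ᵥ v) / (4 * (‖v‖ ^ 2 + 1))) (by positivity)
    have h1 := H δ (by rw [abs_of_pos hδ])
    have h2 := H (-δ) (by rw [abs_neg, abs_of_pos hδ])
    set q := v ⬝ᵥ Y *ᵥ v
    have h3 : q / (4 * (‖v‖ ^ 2 + 1)) * ‖v‖ ^ 2 ≤ q / 4 := by
      rw [div_mul_eq_mul_div, div_le_iff₀ hd]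
      nlinarith
    have h4 : 0 < δ ^ 2 := by positivity
    have h5 := mul_le_mul_of_nonneg_left h3 h4.le
    have h6 : 0 < δ ^ 2 * q := by positivity
    nlinarith

theorem aux_trace {N M : ℕ} (S : Matrix (Fin N) (Fin M) ℝ) (Y : Matrix (Fin N) (Fin N) ℝ)
    (h : ∀ v : Fin N → ℝ, v ⬝ᵥ Y *ᵥ v ≤ 0) :
    trace ((((1 : ℝ) / 2) • (S * Sᵀ)) * Y) ≤ 0 := by
  have e : trace ((S * Sᵀ) * Y) = ∑ j, (fun i => S i j) ⬝ᵥ Y *ᵥ (fun i => S i j) := by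
    rw [Matrix.mul_assoc, trace_mul_comm, Matrix.mul_assoc]
    rfl
  rw [smul_mul_assoc, trace_smul, e, smul_eq_mul]
  have := Finset.sum_nonpos (s := Finset.univ) fun j _ => h (fun i => S i j)
  linarith

/-- If `V` is lower semicontinuous on the open set `O` and, for every `μ ≤ μ̄`, the
sublevel set `K_μ = {x ∈ O : V x ≤ μ}` is closed, has boundary contained in `O`, and
satisfies the second-order Nagumo-type condition, then `V̄ = min (V, μ̄)` is a viscosity
supersolution of the constrained HJB inequality on `O`. -/
theorem truncation_is_supersolution_of_nagumo
    {N M : ℕ} (hN : 0 < N) (hM : 0 < M)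
    {A : Type*} [MetricSpace A] [CompactSpace A] [Nonempty A]
    (f : (Fin N → ℝ) → A → (Fin N → ℝ))
    (σ : (Fin N → ℝ) → A → Matrix (Fin N) (Fin M) ℝ)
    (hf : Continuous fun q : (Fin N → ℝ) × A => f q.1 q.2)
    (hσ : Continuous fun q : (Fin N → ℝ) × A => σ q.1 q.2)
    (O : Set (Fin N → ℝ)) (hO : IsOpen O)
    (V : (Fin N → ℝ) → ℝ)
    (hV : LowerSemicontinuousOn V O)
    (μbar : ℝ)
    (hclosed : ∀ μ ≤ μbar, IsClosed {x | x ∈ O ∧ V x ≤ μ})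
    (hbd : ∀ μ ≤ μbar, frontier {x | x ∈ O ∧ V x ≤ μ} ⊆ O)
    (hnagumo : ∀ μ ≤ μbar, ∀ x ∈ frontier {x | x ∈ O ∧ V x ≤ μ},
      ∀ (p : Fin N → ℝ) (Y : Matrix (Fin N) (Fin N) ℝ),
        InNormalCone {x | x ∈ O ∧ V x ≤ μ} x p Y → ∃ α : A,
          (σ x α)ᵀ *ᵥ p = 0 ∧
          0 ≤ f x α ⬝ᵥ p + trace ((((1 : ℝ) / 2) • (σ x α * (σ x α)ᵀ)) * Y)) :
    IsSupersolution f σ O (fun x => min (V x) μbar) := by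
  intro x hx p Y ⟨hY, hJ⟩
  have hloc : (∀ᶠ y in 𝓝 x, min (V y) μbar ≤ min (V x) μbar) → ∃ α : A,
      (σ x α)ᵀ *ᵥ p = 0 ∧
      0 ≤ -(p ⬝ᵥ f x α) - trace ((((1 : ℝ) / 2) • (σ x α * (σ x α)ᵀ)) * Y) := by
    intro hmax
    obtain ⟨r, hr, hball⟩ := Metric.eventually_nhds_iff.1 (hmax.and (hO.mem_nhds hx))
    obtain ⟨hp, hq⟩ := aux_max p Y (by
      intro ε hε
      obtain ⟨δ, hδ, H⟩ := hJ ε hε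
      refine ⟨min δ (r / 2), lt_min hδ (by positivity), fun v hv => ?_⟩
      have h1 : dist (x + v) x < r := by
        rw [dist_eq_norm, add_sub_cancel_left]
        have := hv.trans (min_le_right _ _)
        linarith
      obtain ⟨h2, h3⟩ := hball h1
      have h4 := H (x + v) h3 (by
        rw [add_sub_cancel_left]; exact hv.trans (min_le_left _ _))
      rw [add_sub_cancel_left] at h4
      linarith)
    obtain ⟨α⟩ := ‹Nonempty A›
    refine ⟨α, by simp [hp], ?_⟩
    have := aux_trace (σ x α) Y hq
    rw [hp, zero_dotProduct]
    linarith
  by_cases hc : V x ≤ μbar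
  · have hm : min (V x) μbar = V x := min_eq_left hc
    by_cases hi : x ∈ interior {y | y ∈ O ∧ V y ≤ V x}
    · apply hloc
      filter_upwards [mem_interior_iff_mem_nhds.1 hi] with y hy
      exact min_le_min_right _ hy.2
    · obtain ⟨α, h1, h2⟩ := hnagumo (V x) hc x
        ⟨subset_closure ⟨hx, le_rfl⟩, hi⟩ (-p) (-Y) (by
          refine ⟨by rw [Matrix.IsSymm, transpose_neg, hY.eq], fun ε hε => ?_⟩
          obtain ⟨δ, hδ, H⟩ := hJ ε hε
          refine ⟨δ, hδ, fun y hy hyd => ?_⟩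
          have h3 := H y hy.1 hyd
          have h4 : min (V y) μbar ≤ V y := min_le_left _ _
          have h5 := hy.2
          simp only [hm] at h3
          rw [neg_dotProduct, neg_mulVec, dotProduct_neg]
          linarith)
      refine ⟨α, by simpa [mulVec_neg] using h1, ?_⟩
      rw [dotProduct_neg, Matrix.mul_neg, trace_neg, dotProduct_comm] at h2
      linarith
  · apply hloc
    refine Filter.Eventually.of_forall fun y => ?_
    rw [min_eq_right (not_le.1 hc).le]
    exact min_le_right _ _
end

section
/- For x, p ∈ ℝ^N and a symmetric N×N real matrix X, define F(x,p,X) := sup { −p·f(x,α) − trace[a(x,α)X] : α ∈ A, σ(x,α)ᵀp = 0 }. Suppose the constraint set {α ∈ A : σ(x,α)ᵀp = 0} is nonempty (the supremum is then finite since A is compact and f, σ are continuous). Then for every λ > 0 and every μ ∈ ℝ, the constraint set associated with (x, λp) coincides with that of (x, p), and F(x, λp, λX + μ·p⊗p) = λ·F(x, p, X), where p⊗p denotes the N×N matrix with entries p_i p_j; that is, the nonlinearity F is geometric. -/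
open Matrix Filter Topology

/-- The nonlinearity `F(x,p,X) = sup { -p·f(x,α) - trace[a(x,α) X] : α ∈ A, σ(x,α)ᵀ p = 0 }`
(with `a := (1/2) σ σᵀ`) is geometric: for `λ > 0` and `μ ∈ ℝ`, the constraint set of
`(x, λp)` coincides with that of `(x, p)` and `F(x, λp, λX + μ p⊗p) = λ F(x, p, X)`. -/
theorem nonlinearity_is_geometric
    {N M : ℕ} (hN : 0 < N) (hM : 0 < M)
    {A : Type*} [MetricSpace A] [CompactSpace A]
    (f : (Fin N → ℝ) → A → (Fin N → ℝ))
    (σ : (Fin N → ℝ) → A → Matrix (Fin N) (Fin M) ℝ)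
    (hf : Continuous fun q : (Fin N → ℝ) × A => f q.1 q.2)
    (hσ : Continuous fun q : (Fin N → ℝ) × A => σ q.1 q.2)
    (F : (Fin N → ℝ) → (Fin N → ℝ) → Matrix (Fin N) (Fin N) ℝ → ℝ)
    (hF : ∀ (x p : Fin N → ℝ) (X : Matrix (Fin N) (Fin N) ℝ),
      F x p X = sSup ((fun α : A =>
          -(p ⬝ᵥ f x α) - trace ((((1 : ℝ) / 2) • (σ x α * (σ x α)ᵀ)) * X)) ''
        {α : A | (σ x α)ᵀ *ᵥ p = 0}))
    (x p : Fin N → ℝ) (X : Matrix (Fin N) (Fin N) ℝ) (hX : X.IsSymm)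
    (hne : {α : A | (σ x α)ᵀ *ᵥ p = 0}.Nonempty)
    (lam : ℝ) (hlam : 0 < lam) (μ : ℝ) :
    {α : A | (σ x α)ᵀ *ᵥ (lam • p) = 0} = {α : A | (σ x α)ᵀ *ᵥ p = 0} ∧
    F x (lam • p) (lam • X + μ • vecMulVec p p) = lam * F x p X := by
  have hset : {α : A | (σ x α)ᵀ *ᵥ (lam • p) = 0} = {α : A | (σ x α)ᵀ *ᵥ p = 0} := by
    ext α
    simp only [Set.mem_setOf_eq, Matrix.mulVec_smul, smul_eq_zero, hlam.ne', false_or]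
  refine ⟨hset, ?_⟩
  rw [hF, hF, hset, ← smul_eq_mul, ← Real.sSup_smul_of_nonneg hlam.le]
  congr 1
  rw [← Set.image_smul, Set.image_image]
  apply Set.image_congr
  intro α hα
  have hα' : (σ x α)ᵀ *ᵥ p = 0 := hα
  have h0 : (σ x α * (σ x α)ᵀ) * vecMulVec p p = 0 := by
    rw [Matrix.mul_assoc, Matrix.mul_vecMulVec, hα', Matrix.zero_vecMulVec, Matrix.mul_zero]
  simp only [Matrix.mul_add, Matrix.mul_smul, Matrix.smul_mul, h0, smul_zero, add_zero,
    Matrix.trace_smul, smul_dotProduct, smul_eq_mul]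
  ring
end

section
/- Let O ⊆ ℝ^N be open and let V_n : O → ℝ be a sequence of lower semicontinuous viscosity supersolutions of the constrained Hamilton–Jacobi–Bellman inequality on O that converges uniformly on compact subsets of O to a function V : O → ℝ. Then V is lower semicontinuous and is a viscosity supersolution of the constrained Hamilton–Jacobi–Bellman inequality on O. -/
open Matrix Filter Topology

theorem quad_expand {d : ℕ} (p h k : Fin d → ℝ) (Z : Matrix (Fin d) (Fin d) ℝ) (hZ : Z.IsSymm) :
    p ⬝ᵥ (h + k) + (1 / 2) * ((h + k) ⬝ᵥ Z *ᵥ (h + k)) =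
      p ⬝ᵥ h + (1 / 2) * (h ⬝ᵥ Z *ᵥ h) + (p + Z *ᵥ h) ⬝ᵥ k + (1 / 2) * (k ⬝ᵥ Z *ᵥ k) := by
  have h1 : h ⬝ᵥ Z *ᵥ k = k ⬝ᵥ Z *ᵥ h := by
    rw [Matrix.dotProduct_mulVec, ← Matrix.mulVec_transpose, hZ.eq, dotProduct_comm]
  have h2 : (Z *ᵥ h) ⬝ᵥ k = k ⬝ᵥ Z *ᵥ h := dotProduct_comm _ _
  simp only [Matrix.mulVec_add, dotProduct_add, add_dotProduct, h1, h2]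
  ring

theorem norm_sq_le_dot {d : ℕ} (h : Fin d → ℝ) : ‖h‖ ^ 2 ≤ h ⬝ᵥ h := by
  have h0 : 0 ≤ h ⬝ᵥ h := Finset.sum_nonneg fun i _ => mul_self_nonneg _
  have : ‖h‖ ≤ Real.sqrt (h ⬝ᵥ h) := by
    rw [pi_norm_le_iff_of_nonneg (Real.sqrt_nonneg _)]
    intro i
    rw [Real.norm_eq_abs]
    apply Real.abs_le_sqrt
    rw [sq]
    exact Finset.single_le_sum (f := fun i => h i * h i) (fun i _ => mul_self_nonneg _)
      (Finset.mem_univ i)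
  calc ‖h‖ ^ 2 ≤ Real.sqrt (h ⬝ᵥ h) ^ 2 := by gcongr
    _ = _ := Real.sq_sqrt h0

theorem subjet_of_min {d : ℕ} (O : Set (Fin d → ℝ)) (W : (Fin d → ℝ) → ℝ)
    (x z p : Fin d → ℝ) (Z : Matrix (Fin d) (Fin d) ℝ) (hZ : Z.IsSymm) (r : ℝ) (hr : 0 < r)
    (hmin : ∀ y ∈ O, ‖y - z‖ ≤ r →
      W z - (p ⬝ᵥ (z - x) + (1 / 2) * ((z - x) ⬝ᵥ Z *ᵥ (z - x))) ≤
      W y - (p ⬝ᵥ (y - x) + (1 / 2) * ((y - x) ⬝ᵥ Z *ᵥ (y - x)))) :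
    InSubjet O W z (p + Z *ᵥ (z - x)) Z := by
  refine ⟨hZ, fun ε hε => ⟨r, hr, fun y hy hyr => ?_⟩⟩
  have h1 := hmin y hy hyr
  have h2 := quad_expand p (z - x) (y - z) Z hZ
  have h3 : z - x + (y - z) = y - x := by abel
  rw [h3] at h2
  have : 0 ≤ ε * ‖y - z‖ ^ 2 := by positivity
  linarith

theorem closed_good {N M : ℕ} {A : Type*} [MetricSpace A] [CompactSpace A]
    (f : (Fin N → ℝ) → A → (Fin N → ℝ))
    (σ : (Fin N → ℝ) → A → Matrix (Fin N) (Fin M) ℝ)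
    (hf : Continuous fun q : (Fin N → ℝ) × A => f q.1 q.2)
    (hσ : Continuous fun q : (Fin N → ℝ) × A => σ q.1 q.2) :
    IsClosed {t : (Fin N → ℝ) × (Fin N → ℝ) × Matrix (Fin N) (Fin N) ℝ | ∃ α : A,
      (σ t.1 α)ᵀ *ᵥ t.2.1 = 0 ∧
      0 ≤ -(t.2.1 ⬝ᵥ f t.1 α) - trace ((((1 : ℝ) / 2) • (σ t.1 α * (σ t.1 α)ᵀ)) * t.2.2)} := by
  have hf' : Continuous fun s : ((Fin N → ℝ) × (Fin N → ℝ) × Matrix (Fin N) (Fin N) ℝ) × A => f s.1.1 s.2 :=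
    hf.comp (f := fun s : ((Fin N → ℝ) × (Fin N → ℝ) × Matrix (Fin N) (Fin N) ℝ) × A => (s.1.1, s.2)) (by fun_prop)
  have hσ' : Continuous fun s : ((Fin N → ℝ) × (Fin N → ℝ) × Matrix (Fin N) (Fin N) ℝ) × A => σ s.1.1 s.2 :=
    hσ.comp (f := fun s : ((Fin N → ℝ) × (Fin N → ℝ) × Matrix (Fin N) (Fin N) ℝ) × A => (s.1.1, s.2)) (by fun_prop)
  have hp : Continuous fun s : ((Fin N → ℝ) × (Fin N → ℝ) × Matrix (Fin N) (Fin N) ℝ) × A => s.1.2.1 := by fun_prop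
  have hY : Continuous fun s : ((Fin N → ℝ) × (Fin N → ℝ) × Matrix (Fin N) (Fin N) ℝ) × A => s.1.2.2 := by fun_prop
  have hc : IsClosed {s : ((Fin N → ℝ) × (Fin N → ℝ) × Matrix (Fin N) (Fin N) ℝ) × A | (σ s.1.1 s.2)ᵀ *ᵥ s.1.2.1 = 0 ∧
      0 ≤ -(s.1.2.1 ⬝ᵥ f s.1.1 s.2)
        - trace ((((1 : ℝ) / 2) • (σ s.1.1 s.2 * (σ s.1.1 s.2)ᵀ)) * s.1.2.2)} := by
    apply IsClosed.inter
    · exact isClosed_eq (hσ'.matrix_transpose.matrix_mulVec hp) continuous_const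
    · refine isClosed_le continuous_const ((hp.dotProduct hf').neg.sub ?_)
      have h1 := hσ'.matrix_mul hσ'.matrix_transpose
      have h2 : Continuous fun s : ((Fin N → ℝ) × (Fin N → ℝ) × Matrix (Fin N) (Fin N) ℝ) × A =>
          ((1 : ℝ) / 2) • (σ s.1.1 s.2 * (σ s.1.1 s.2)ᵀ) := h1.const_smul ((1 : ℝ) / 2)
      exact (h2.matrix_mul hY).matrix_trace
  have := isClosedMap_fst_of_compactSpace (X := ((Fin N → ℝ) × (Fin N → ℝ) × Matrix (Fin N) (Fin N) ℝ)) (Y := A) _ hc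
  convert this using 1
  ext t
  simp

theorem lsc_limit {d : ℕ} (O : Set (Fin d → ℝ)) (hO : IsOpen O)
    (Vseq : ℕ → (Fin d → ℝ) → ℝ)
    (hlsc : ∀ n, LowerSemicontinuousOn (Vseq n) O)
    (V : (Fin d → ℝ) → ℝ)
    (hconv : ∀ K : Set (Fin d → ℝ), K ⊆ O → IsCompact K →
      TendstoUniformlyOn Vseq V atTop K) : LowerSemicontinuousOn V O := by
  intro x hx c hc
  obtain ⟨r, hr, hrO⟩ := Metric.nhds_basis_closedBall.mem_iff.1 (hO.mem_nhds hx)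
  have he : 0 < (V x - c) / 3 := by linarith
  obtain ⟨n, hn⟩ := (Metric.tendstoUniformlyOn_iff.1
    (hconv _ hrO (isCompact_closedBall x r)) _ he).exists
  have h1 := hlsc n x hx (Vseq n x - (V x - c) / 3) (by linarith)
  have h2 : ∀ᶠ y in 𝓝[O] x, y ∈ Metric.closedBall x r :=
    nhdsWithin_le_nhds (Metric.closedBall_mem_nhds x hr)
  filter_upwards [h1, h2] with y hy1 hy2
  have a1 := abs_lt.1 (by simpa [Real.dist_eq] using hn y hy2)
  have a2 := abs_lt.1 (by simpa [Real.dist_eq] using hn x (Metric.mem_closedBall_self hr.le))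
  linarith [a1.1, a1.2, a2.1, a2.2]

theorem approx_step {N M : ℕ} {A : Type*}
    (f : (Fin N → ℝ) → A → (Fin N → ℝ))
    (σ : (Fin N → ℝ) → A → Matrix (Fin N) (Fin M) ℝ)
    (O : Set (Fin N → ℝ)) (hO : IsOpen O)
    (Vseq : ℕ → (Fin N → ℝ) → ℝ)
    (hlsc : ∀ n, LowerSemicontinuousOn (Vseq n) O)
    (hsuper : ∀ n, IsSupersolution f σ O (Vseq n))
    (V : (Fin N → ℝ) → ℝ)
    (hconv : ∀ K : Set (Fin N → ℝ), K ⊆ O → IsCompact K →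
      TendstoUniformlyOn Vseq V atTop K)
    (x : Fin N → ℝ) (hx : x ∈ O) (p : Fin N → ℝ) (Y : Matrix (Fin N) (Fin N) ℝ)
    (hJ : InSubjet O V x p Y) (η : ℝ) (hη : 0 < η) (ρ : ℝ) (hρ : 0 < ρ) :
    ∃ z, ‖z - x‖ < ρ ∧ ∃ α : A,
      (σ z α)ᵀ *ᵥ (p + (Y - (4 * η) • 1) *ᵥ (z - x)) = 0 ∧
      0 ≤ -((p + (Y - (4 * η) • 1) *ᵥ (z - x)) ⬝ᵥ f z α)
        - trace ((((1 : ℝ) / 2) • (σ z α * (σ z α)ᵀ)) * (Y - (4 * η) • 1)) := by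
  obtain ⟨hYs, hY⟩ := hJ
  obtain ⟨δ, hδ, hV⟩ := hY η hη
  obtain ⟨r₀, hr₀, hrO⟩ := Metric.nhds_basis_closedBall.mem_iff.1 (hO.mem_nhds hx)
  obtain ⟨r, hr, hrδ, hrr, hrρ⟩ : ∃ r, 0 < r ∧ r ≤ δ ∧ r ≤ r₀ ∧ r ≤ ρ :=
    ⟨min δ (min r₀ ρ), by positivity, min_le_left _ _,
      (min_le_right _ _).trans (min_le_left _ _), (min_le_right _ _).trans (min_le_right _ _)⟩
  have hBO : Metric.closedBall x r ⊆ O := (Metric.closedBall_subset_closedBall hrr).trans hrO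
  have hK := isCompact_closedBall x r
  have he : 0 < η * r ^ 2 / 4 := by positivity
  obtain ⟨n, hn⟩ := (Metric.tendstoUniformlyOn_iff.1 (hconv _ hBO hK) _ he).exists
  have hZ : (Y - (4 * η) • (1 : Matrix (Fin N) (Fin N) ℝ)).IsSymm :=
    hYs.sub (Matrix.isSymm_one.smul _)
  set Z := Y - (4 * η) • (1 : Matrix (Fin N) (Fin N) ℝ) with hZdef
  let φ : (Fin N → ℝ) → ℝ := fun y => p ⬝ᵥ (y - x) + (1 / 2) * ((y - x) ⬝ᵥ Z *ᵥ (y - x))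
  have hφ : Continuous φ := by
    have h1 : Continuous fun y : Fin N → ℝ => y - x := by fun_prop
    exact (continuous_const.dotProduct h1).add
      (continuous_const.mul (h1.dotProduct (continuous_const.matrix_mulVec h1)))
  have hl : LowerSemicontinuousOn (fun y => Vseq n y + (- φ y)) (Metric.closedBall x r) :=
    ((hlsc n).mono hBO).add (hφ.neg.lowerSemicontinuous.lowerSemicontinuousOn _)
  obtain ⟨z, hz, hzmin⟩ := hl.exists_isMinOn ⟨x, Metric.mem_closedBall_self hr.le⟩ hK
  have hzmin' : ∀ y ∈ Metric.closedBall x r, Vseq n z + (- φ z) ≤ Vseq n y + (- φ y) :=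
    fun y hy => hzmin hy
  have hφx : φ x = 0 := by simp [φ]
  have hzr : ‖z - x‖ ≤ r := by simpa [dist_eq_norm] using hz
  have hzlt : ‖z - x‖ < r := by
    have b1 := hzmin' x (Metric.mem_closedBall_self hr.le)
    have b2 := hV z (hBO hz) (hzr.trans hrδ)
    have b3 : φ z = p ⬝ᵥ (z - x) + (1 / 2) * ((z - x) ⬝ᵥ Y *ᵥ (z - x))
        - 2 * η * ((z - x) ⬝ᵥ (z - x)) := by
      simp only [φ, hZdef, Matrix.sub_mulVec, dotProduct_sub, Matrix.smul_mulVec,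
        Matrix.one_mulVec, dotProduct_smul, smul_eq_mul]
      ring
    have b4 := mul_le_mul_of_nonneg_left (norm_sq_le_dot (z - x)) hη.le
    have a1 := abs_lt.1 (by simpa [Real.dist_eq] using hn z hz)
    have a2 := abs_lt.1 (by simpa [Real.dist_eq] using hn x (Metric.mem_closedBall_self hr.le))
    have b5 : η * ‖z - x‖ ^ 2 < η * r ^ 2 := by
      nlinarith [a1.1, a1.2, a2.1, a2.2]
    exact lt_of_pow_lt_pow_left₀ 2 hr.le (lt_of_mul_lt_mul_left b5 hη.le)
  refine ⟨z, hzlt.trans_le hrρ, hsuper n z (hBO hz) _ _ ?_⟩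
  refine subjet_of_min O _ x z p Z hZ (r - ‖z - x‖) (by linarith) fun y _ hyr => ?_
  have hyB : y ∈ Metric.closedBall x r := by
    rw [Metric.mem_closedBall, dist_eq_norm]
    have := norm_add_le (y - z) (z - x)
    rw [sub_add_sub_cancel] at this
    linarith
  have := hzmin' y hyB
  simp only [φ] at this
  linarith

/-- Stability of viscosity supersolutions of the constrained HJB inequality with respect to
uniform convergence on compact subsets of `O`. -/
theorem supersolution_stable_under_locally_uniform_convergence
    {N M : ℕ} (hN : 0 < N) (hM : 0 < M)
    {A : Type*} [MetricSpace A] [CompactSpace A]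
    (f : (Fin N → ℝ) → A → (Fin N → ℝ))
    (σ : (Fin N → ℝ) → A → Matrix (Fin N) (Fin M) ℝ)
    (hf : Continuous fun q : (Fin N → ℝ) × A => f q.1 q.2)
    (hσ : Continuous fun q : (Fin N → ℝ) × A => σ q.1 q.2)
    (O : Set (Fin N → ℝ)) (hO : IsOpen O)
    (Vseq : ℕ → (Fin N → ℝ) → ℝ)
    (hlsc : ∀ n, LowerSemicontinuousOn (Vseq n) O)
    (hsuper : ∀ n, IsSupersolution f σ O (Vseq n))
    (V : (Fin N → ℝ) → ℝ)
    (hconv : ∀ K : Set (Fin N → ℝ), K ⊆ O → IsCompact K →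
      TendstoUniformlyOn Vseq V atTop K) :
    LowerSemicontinuousOn V O ∧ IsSupersolution f σ O V := by
  refine ⟨lsc_limit O hO Vseq hlsc V hconv, fun x hx p Y hJ => ?_⟩
  have hcl := closed_good f σ hf hσ
  have key : ∀ k : ℕ, ∃ z, ‖z - x‖ < 1 / ((k : ℝ) + 1) ∧ ∃ α : A,
      (σ z α)ᵀ *ᵥ (p + (Y - (4 * (1 / ((k : ℝ) + 1))) • 1) *ᵥ (z - x)) = 0 ∧
      0 ≤ -((p + (Y - (4 * (1 / ((k : ℝ) + 1))) • 1) *ᵥ (z - x)) ⬝ᵥ f z α)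
        - trace ((((1 : ℝ) / 2) • (σ z α * (σ z α)ᵀ)) * (Y - (4 * (1 / ((k : ℝ) + 1))) • 1)) :=
    fun k => approx_step f σ O hO Vseq hlsc hsuper V hconv x hx p Y hJ _ (by positivity) _
      (by positivity)
  choose z hz hα using key
  have h0 : Tendsto (fun k : ℕ => 1 / ((k : ℝ) + 1)) atTop (𝓝 0) :=
    tendsto_one_div_add_atTop_nhds_zero_nat
  have hzx0 : Tendsto (fun k => z k - x) atTop (𝓝 0) :=
    squeeze_zero_norm (fun k => (hz k).le) h0
  have hzx : Tendsto z atTop (𝓝 x) := by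
    simpa using hzx0.add_const x
  have hYk : Tendsto (fun k : ℕ => Y - (4 * (1 / ((k : ℝ) + 1))) •
      (1 : Matrix (Fin N) (Fin N) ℝ)) atTop (𝓝 Y) := by
    have := ((h0.const_mul 4).smul_const (1 : Matrix (Fin N) (Fin N) ℝ)).const_sub Y
    simpa using this
  have hpk : Tendsto (fun k : ℕ => p + (Y - (4 * (1 / ((k : ℝ) + 1))) •
      (1 : Matrix (Fin N) (Fin N) ℝ)) *ᵥ (z k - x)) atTop (𝓝 p) := by
    have hc : Continuous fun q : Matrix (Fin N) (Fin N) ℝ × (Fin N → ℝ) => p + q.1 *ᵥ q.2 :=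
      continuous_const.add (continuous_fst.matrix_mulVec continuous_snd)
    have := (hc.tendsto (Y, 0)).comp (hYk.prodMk_nhds hzx0)
    simpa [Function.comp_def] using this
  exact hcl.mem_of_tendsto (hzx.prodMk_nhds (hpk.prodMk_nhds hYk)) (Eventually.of_forall hα)
end

section
/- Let O ⊆ ℝ^N be open and let V_n : O → ℝ be a nondecreasing sequence (V_n ≤ V_{n+1} pointwise) of lower semicontinuous viscosity supersolutions of the constrained Hamilton–Jacobi–Bellman inequality on O, and assume that V(x) := sup_n V_n(x) is finite for every x ∈ O. Then V is lower semicontinuous and is a viscosity supersolution of the constrained Hamilton–Jacobi–Bellman inequality on O. -/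
open Matrix Filter Topology

lemma aux_quad_s8 {N : ℕ} (p h k : Fin N → ℝ) (Z : Matrix (Fin N) (Fin N) ℝ) (hZ : Z.IsSymm) :
    p ⬝ᵥ (h + k) + (1/2) * ((h + k) ⬝ᵥ Z *ᵥ (h + k)) =
    (p ⬝ᵥ h + (1/2) * (h ⬝ᵥ Z *ᵥ h)) + (p + Z *ᵥ h) ⬝ᵥ k + (1/2) * (k ⬝ᵥ Z *ᵥ k) := by
  have e : h ⬝ᵥ Z *ᵥ k = k ⬝ᵥ Z *ᵥ h := by
    rw [dotProduct_mulVec, ← mulVec_transpose, hZ.eq, dotProduct_comm]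
  have e2 : (Z *ᵥ h) ⬝ᵥ k = k ⬝ᵥ Z *ᵥ h := dotProduct_comm _ _
  simp only [mulVec_add, dotProduct_add, add_dotProduct, e, e2]
  ring

lemma aux_norm {N : ℕ} (h : Fin N → ℝ) : ‖h‖ ^ 2 ≤ h ⬝ᵥ h := by
  have h0 : 0 ≤ h ⬝ᵥ h := Finset.sum_nonneg fun i _ => mul_self_nonneg (h i)
  have : ‖h‖ ≤ √(h ⬝ᵥ h) := by
    rw [pi_norm_le_iff_of_nonneg (Real.sqrt_nonneg _)]
    intro i
    apply Real.le_sqrt_of_sq_le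
    rw [Real.norm_eq_abs, sq_abs, sq]
    exact Finset.single_le_sum (f := fun i => h i * h i)
      (fun i _ => mul_self_nonneg (h i)) (Finset.mem_univ i)
  calc ‖h‖ ^ 2 ≤ √(h ⬝ᵥ h) ^ 2 := by gcongr
    _ = _ := Real.sq_sqrt h0

/-- The set of jets where the inequality holds. -/
def auxG {N M : ℕ} {A : Type*}
    (f : (Fin N → ℝ) → A → (Fin N → ℝ))
    (σ : (Fin N → ℝ) → A → Matrix (Fin N) (Fin M) ℝ) :
    Set ((Fin N → ℝ) × (Fin N → ℝ) × Matrix (Fin N) (Fin N) ℝ) :=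
  {t | ∃ α : A, (σ t.1 α)ᵀ *ᵥ t.2.1 = 0 ∧
    0 ≤ -(t.2.1 ⬝ᵥ f t.1 α) - trace ((((1 : ℝ) / 2) • (σ t.1 α * (σ t.1 α)ᵀ)) * t.2.2)}

lemma auxG_closed {N M : ℕ} {A : Type*} [MetricSpace A] [CompactSpace A]
    (f : (Fin N → ℝ) → A → (Fin N → ℝ))
    (σ : (Fin N → ℝ) → A → Matrix (Fin N) (Fin M) ℝ)
    (hf : Continuous fun q : (Fin N → ℝ) × A => f q.1 q.2)
    (hσ : Continuous fun q : (Fin N → ℝ) × A => σ q.1 q.2) : IsClosed (auxG f σ) := by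
  let S : Set (A × ((Fin N → ℝ) × (Fin N → ℝ) × Matrix (Fin N) (Fin N) ℝ)) :=
    {s | (σ s.2.1 s.1)ᵀ *ᵥ s.2.2.1 = 0 ∧
    0 ≤ -(s.2.2.1 ⬝ᵥ f s.2.1 s.1) -
      trace ((((1 : ℝ) / 2) • (σ s.2.1 s.1 * (σ s.2.1 s.1)ᵀ)) * s.2.2.2)}
  have hf' : Continuous fun s : A × ((Fin N → ℝ) × (Fin N → ℝ) × Matrix (Fin N) (Fin N) ℝ) =>
      f s.2.1 s.1 := hf.comp (by fun_prop : Continuous fun s : A × ((Fin N → ℝ) × (Fin N → ℝ) ×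
        Matrix (Fin N) (Fin N) ℝ) => (s.2.1, s.1))
  have hσ' : Continuous fun s : A × ((Fin N → ℝ) × (Fin N → ℝ) × Matrix (Fin N) (Fin N) ℝ) =>
      σ s.2.1 s.1 := hσ.comp (by fun_prop : Continuous fun s : A × ((Fin N → ℝ) × (Fin N → ℝ) ×
        Matrix (Fin N) (Fin N) ℝ) => (s.2.1, s.1))
  have hS : IsClosed S := by
    have c1 : Continuous fun s : A × ((Fin N → ℝ) × (Fin N → ℝ) × Matrix (Fin N) (Fin N) ℝ) =>
        (σ s.2.1 s.1)ᵀ *ᵥ s.2.2.1 := Continuous.matrix_mulVec hσ'.matrix_transpose (by fun_prop)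
    have c2 : Continuous fun s : A × ((Fin N → ℝ) × (Fin N → ℝ) × Matrix (Fin N) (Fin N) ℝ) =>
        s.2.2.1 ⬝ᵥ f s.2.1 s.1 := Continuous.dotProduct (by fun_prop) hf'
    have c3 : Continuous fun s : A × ((Fin N → ℝ) × (Fin N → ℝ) × Matrix (Fin N) (Fin N) ℝ) =>
        trace ((((1 : ℝ) / 2) • (σ s.2.1 s.1 * (σ s.2.1 s.1)ᵀ)) * s.2.2.2) :=
      (Continuous.matrix_mul ((hσ'.matrix_mul hσ'.matrix_transpose).const_smul ((1 : ℝ) / 2))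
        (by fun_prop)).matrix_trace
    exact (isClosed_eq c1 continuous_const).inter (isClosed_le continuous_const (c2.neg.sub c3))
  have := isClosedMap_snd_of_compactSpace S hS
  convert this using 1
  ext t
  constructor
  · rintro ⟨α, h⟩
    exact ⟨(α, t), h, rfl⟩
  · rintro ⟨⟨α, t'⟩, h, rfl⟩
    exact ⟨α, h⟩

/-- Stability of viscosity supersolutions of the constrained HJB inequality with respect to
pointwise increasing convergence: the finite pointwise supremum of a nondecreasing sequence
of LSC supersolutions is an LSC supersolution. -/
theorem supersolution_stable_under_increasing_convergence
    {N M : ℕ} (hN : 0 < N) (hM : 0 < M)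
    {A : Type*} [MetricSpace A] [CompactSpace A]
    (f : (Fin N → ℝ) → A → (Fin N → ℝ))
    (σ : (Fin N → ℝ) → A → Matrix (Fin N) (Fin M) ℝ)
    (hf : Continuous fun q : (Fin N → ℝ) × A => f q.1 q.2)
    (hσ : Continuous fun q : (Fin N → ℝ) × A => σ q.1 q.2)
    (O : Set (Fin N → ℝ)) (hO : IsOpen O)
    (Vseq : ℕ → (Fin N → ℝ) → ℝ)
    (hlsc : ∀ n, LowerSemicontinuousOn (Vseq n) O)
    (hsuper : ∀ n, IsSupersolution f σ O (Vseq n))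
    (hmono : ∀ n, ∀ x ∈ O, Vseq n x ≤ Vseq (n + 1) x)
    (V : (Fin N → ℝ) → ℝ)
    (hV : ∀ x ∈ O, IsLUB (Set.range fun n => Vseq n x) (V x)) :
    LowerSemicontinuousOn V O ∧ IsSupersolution f σ O V := by
  have hmon : ∀ x ∈ O, Monotone fun n => Vseq n x := fun x hx =>
    monotone_nat_of_le_succ fun n => hmono n x hx
  have hle : ∀ n, ∀ x ∈ O, Vseq n x ≤ V x := fun n x hx => (hV x hx).1 ⟨n, rfl⟩
  refine ⟨?_, ?_⟩
  · intro x hx c hc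
    obtain ⟨_, ⟨n, rfl⟩, hn, -⟩ := (hV x hx).exists_between hc
    filter_upwards [hlsc n x hx c hn, self_mem_nhdsWithin] with y hy hyO
    exact hy.trans_le (hle n y hyO)
  intro x hx p Y ⟨hY, hsub⟩
  have hG := auxG_closed f σ hf hσ
  change (x, p, Y) ∈ auxG f σ
  have key : ∀ ε > (0 : ℝ), (x, p, Y - (4 * ε) • (1 : Matrix (Fin N) (Fin N) ℝ)) ∈ auxG f σ := by
    intro ε hε
    obtain ⟨δ₁, hδ₁, h₁⟩ := hsub ε hε
    obtain ⟨δ₂, hδ₂, h₂⟩ := Metric.nhds_basis_closedBall.mem_iff.1 (hO.mem_nhds hx)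
    set Z := Y - (4 * ε) • (1 : Matrix (Fin N) (Fin N) ℝ) with hZdef
    have hZ : Z.IsSymm := by
      simp only [hZdef, Matrix.IsSymm, transpose_sub, transpose_smul, transpose_one, hY.eq]
    have hZq : ∀ h : Fin N → ℝ, h ⬝ᵥ Z *ᵥ h = h ⬝ᵥ Y *ᵥ h - 4 * ε * (h ⬝ᵥ h) := by
      intro h
      simp [hZdef, sub_mulVec, smul_mulVec, dotProduct_sub, dotProduct_smul]
    let q : (Fin N → ℝ) → ℝ := fun y => p ⬝ᵥ (y - x) + (1/2) * ((y - x) ⬝ᵥ Z *ᵥ (y - x))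
    have hq : Continuous q := by
      have hc : Continuous fun y : Fin N → ℝ => y - x := by fun_prop
      exact (Continuous.dotProduct continuous_const hc).add
        (continuous_const.mul (hc.dotProduct (Continuous.matrix_mulVec continuous_const hc)))
    have hqx : q x = 0 := by simp [q]
    set δ := min δ₁ δ₂ with hδdef
    have hδ : 0 < δ := lt_min hδ₁ hδ₂
    set K := Metric.closedBall x δ with hK
    have hKO : K ⊆ O := (Metric.closedBall_subset_closedBall (min_le_right _ _)).trans h₂
    have hxK : x ∈ K := Metric.mem_closedBall_self hδ.le
    have hKc : IsCompact K := isCompact_closedBall x δ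
    have hVq : ∀ y ∈ K, V y - q y ≥ V x + ε * ‖y - x‖ ^ 2 := by
      intro y hy
      have hy' : ‖y - x‖ ≤ δ₁ := by
        rw [← dist_eq_norm]; exact (Metric.mem_closedBall.1 hy).trans (min_le_left _ _)
      have := h₁ y (hKO hy) hy'
      have h3 := mul_le_mul_of_nonneg_left (aux_norm (y - x)) hε.le
      simp only [q, hZq]
      linarith
    have hls : ∀ n, LowerSemicontinuousOn (fun y => Vseq n y + -q y) O := fun n =>
      (hlsc n).add (hq.neg.lowerSemicontinuous.lowerSemicontinuousOn O)
    have hmin : ∀ n, ∃ y ∈ K, IsMinOn (fun y => Vseq n y + -q y) K y := fun n =>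
      LowerSemicontinuousOn.exists_isMinOn ⟨x, hxK⟩ hKc ((hls n).mono hKO)
    choose y hyK hymin using hmin
    obtain ⟨a, haK, φ, hφ, hlim⟩ := hKc.tendsto_subseq hyK
    have hbd : ∀ n, Vseq n (y n) + -q (y n) ≤ V x := by
      intro n
      have : Vseq n (y n) + -q (y n) ≤ Vseq n x + -q x := hymin n hxK
      have := hle n x hx
      linarith
    have ham : ∀ m, Vseq m a + -q a ≤ V x := by
      intro m
      by_contra! hcon
      have hl' : Tendsto (y ∘ φ) atTop (𝓝[O] a) :=
        tendsto_nhdsWithin_iff.2 ⟨hlim, Eventually.of_forall fun n => hKO (hyK _)⟩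
      have h5 := hl'.eventually (hls m a (hKO haK) _ hcon)
      obtain ⟨n, hn, hmn⟩ := (h5.and (eventually_ge_atTop m)).exists
      have h6 : Vseq m (y (φ n)) ≤ Vseq (φ n) (y (φ n)) :=
        hmon _ (hKO (hyK _)) (hmn.trans (hφ.id_le n))
      have h7 := hbd (φ n)
      simp only [Function.comp] at hn
      linarith
    have hax : a = x := by
      have hVa : V a ≤ V x + q a := by
        refine (hV a (hKO haK)).2 ?_
        rintro _ ⟨m, rfl⟩
        have := ham m
        dsimp only
        linarith
      have h8 := hVq a haK
      have h9 : ‖a - x‖ ^ 2 ≤ 0 := by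
        by_contra! hc
        have := mul_pos hε hc
        linarith
      have h10 : ‖a - x‖ = 0 := by nlinarith [norm_nonneg (a - x)]
      exact sub_eq_zero.1 (norm_eq_zero.1 h10)
    subst hax
    have hmem : ∀ᶠ n in atTop, ((y ∘ φ) n, p + Z *ᵥ ((y ∘ φ) n - a), Z) ∈ auxG f σ := by
      filter_upwards [hlim.eventually (Metric.ball_mem_nhds a hδ)] with n hn
      simp only [Function.comp] at hn ⊢
      refine hsuper (φ n) _ (hKO (hyK _)) _ _ ⟨hZ, fun ε' hε' => ?_⟩
      have hn' : dist (y (φ n)) a < δ := hn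
      refine ⟨δ - dist (y (φ n)) a, by linarith, fun z hz hzd => ?_⟩
      have hzK : z ∈ K := by
        rw [hK, Metric.mem_closedBall]
        rw [← dist_eq_norm] at hzd
        linarith [dist_triangle z (y (φ n)) a]
      have h11 : Vseq (φ n) (y (φ n)) + -q (y (φ n)) ≤ Vseq (φ n) z + -q z := hymin (φ n) hzK
      have h12 := aux_quad_s8 p (y (φ n) - a) (z - y (φ n)) Z hZ
      have h13 : y (φ n) - a + (z - y (φ n)) = z - a := by abel
      rw [h13] at h12
      have h14 : 0 ≤ ε' * ‖z - y (φ n)‖ ^ 2 := by positivity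
      simp only [q] at h11
      linarith
    have hcont : Continuous fun w : Fin N → ℝ => (w, p + Z *ᵥ (w - a), Z) := by
      have hc : Continuous fun w : Fin N → ℝ => w - a := by fun_prop
      exact continuous_id.prodMk ((continuous_const.add
        (Continuous.matrix_mulVec continuous_const hc)).prodMk continuous_const)
    have hfin := hG.mem_of_tendsto ((hcont.tendsto a).comp hlim) hmem
    simpa using hfin
  have hc : Continuous fun ε : ℝ => (x, p, Y - (4 * ε) • (1 : Matrix (Fin N) (Fin N) ℝ)) := by
    fun_prop
  have ht : Tendsto (fun ε : ℝ => (x, p, Y - (4 * ε) • (1 : Matrix (Fin N) (Fin N) ℝ)))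
      (𝓝[>] 0) (𝓝 (x, p, Y)) := by
    have := (hc.tendsto 0).mono_left (nhdsWithin_le_nhds (s := Set.Ioi 0))
    simpa using this
  exact hG.mem_of_tendsto ht (by filter_upwards [self_mem_nhdsWithin] with ε hε using key ε hε)
end

section
/- Let S ⊆ ℝ^N × (0,∞) be monotone in the sense that (x,ε) ∈ S and ε ≤ ε' imply (x,ε') ∈ S. Then the following are equivalent: (i) for every ε > 0 there exists δ > 0 such that (x,ε) ∈ S for all x with 0 < ‖x‖ ≤ δ; (ii) there exist δ₀ > 0 and a function γ of class 𝒦 such that (x, γ(‖x‖)) ∈ S for all x with 0 < ‖x‖ ≤ δ₀. -/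
open Filter Topology

/-- Equivalence between the ε–δ formulation of a.s. stabilizability and the formulation with
a comparison function `γ` of class `𝒦` (continuous, strictly increasing, `γ(0) = 0`,
mapping `[0,∞)` into `[0,∞)`), for a monotone set `S ⊆ ℝ^N × (0,∞)` of admissible pairs
`(x, ε)`. -/
theorem stabilizability_epsilon_delta_iff_class_K
    {N : ℕ} (hN : 0 < N)
    (S : Set ((Fin N → ℝ) × ℝ))
    (hSpos : ∀ z ∈ S, 0 < z.2)
    (hmono : ∀ (x : Fin N → ℝ) (ε ε' : ℝ), (x, ε) ∈ S → ε ≤ ε' → (x, ε') ∈ S) :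
    (∀ ε > (0 : ℝ), ∃ δ > (0 : ℝ), ∀ x : Fin N → ℝ, 0 < ‖x‖ → ‖x‖ ≤ δ → (x, ε) ∈ S) ↔
    (∃ δ₀ > (0 : ℝ), ∃ γ : ℝ → ℝ,
      ContinuousOn γ (Set.Ici 0) ∧ StrictMonoOn γ (Set.Ici 0) ∧ γ 0 = 0 ∧
      (∀ r ∈ Set.Ici (0 : ℝ), 0 ≤ γ r) ∧
      ∀ x : Fin N → ℝ, 0 < ‖x‖ → ‖x‖ ≤ δ₀ → (x, γ ‖x‖) ∈ S) := by
  constructor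
  · intro h
    choose! d hd0 hd using h
    have hp : ∀ n : ℕ, (0 : ℝ) < (1 / 2 : ℝ) ^ n := fun n => by positivity
    set D : ℕ → ℝ := fun n => min (d ((1 / 2 : ℝ) ^ n)) ((1 / 2 : ℝ) ^ n) with hD
    have hDpos : ∀ n, 0 < D n := fun n => lt_min (hd0 _ (hp n)) (hp n)
    set f : ℕ → ℝ → ℝ := fun n r => 2 * (1 / 2 : ℝ) ^ n * min 1 (|r| / D n) with hf
    have hf0 : ∀ n r, 0 ≤ f n r := fun n r => by
      have : 0 ≤ |r| / D n := div_nonneg (abs_nonneg _) (hDpos n).le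
      have h2 : 0 ≤ min 1 (|r| / D n) := le_min zero_le_one this
      have := hp n
      simp only [hf]
      positivity
    have hf1 : ∀ n r, f n r ≤ 2 * (1 / 2 : ℝ) ^ n := fun n r => by
      have h2 : min 1 (|r| / D n) ≤ 1 := min_le_left _ _
      have := hp n
      simp only [hf]
      nlinarith
    have hsum : Summable (fun n : ℕ => 2 * (1 / 2 : ℝ) ^ n) :=
      (summable_geometric_of_lt_one (by norm_num) (by norm_num)).mul_left 2
    have hfs : ∀ r, Summable (fun n => f n r) := fun r =>
      Summable.of_nonneg_of_le (fun n => hf0 n r) (fun n => hf1 n r) hsum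
    have hcont : Continuous (fun r => ∑' n, f n r) := by
      refine continuous_tsum (fun n => ?_) hsum (fun n r => ?_)
      · simp only [hf]
        fun_prop
      · rw [Real.norm_of_nonneg (hf0 n r)]
        exact hf1 n r
    have hts0 : ∀ r, 0 ≤ ∑' n, f n r := fun r => tsum_nonneg (fun n => hf0 n r)
    refine ⟨D 0, hDpos 0, fun r => r + ∑' n, f n r, ?_, ?_, ?_, ?_, ?_⟩
    · exact (continuous_id.add hcont).continuousOn
    · intro a ha b hb hab
      refine add_lt_add_of_lt_of_le hab ?_
      refine Summable.tsum_le_tsum (fun n => ?_) (hfs a) (hfs b)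
      simp only [hf]
      have h1 : |a| ≤ |b| := by
        rw [abs_of_nonneg ha, abs_of_nonneg hb]; exact hab.le
      refine mul_le_mul_of_nonneg_left ?_ (by positivity)
      exact min_le_min_left _ (div_le_div_of_nonneg_right h1 (hDpos n).le)
    · simp [hf]
    · intro r hr
      exact add_nonneg hr (hts0 r)
    · intro x hx0 hx
      have hex : ∃ n, D n < ‖x‖ := by
        obtain ⟨n, hn⟩ := exists_pow_lt_of_lt_one hx0 (by norm_num : (1 / 2 : ℝ) < 1)
        exact ⟨n, (min_le_right _ _).trans_lt hn⟩
      classical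
      obtain ⟨m, hm⟩ : ∃ m, Nat.find hex = m + 1 := by
        refine Nat.exists_eq_succ_of_ne_zero (fun h0 => ?_)
        have := Nat.find_spec hex
        rw [h0] at this
        exact absurd hx (not_le.mpr this)
      have h1 : D (m + 1) < ‖x‖ := hm ▸ Nat.find_spec hex
      have h2 : ‖x‖ ≤ D m := not_lt.mp (Nat.find_min hex (by omega))
      refine hmono x _ _ (hd _ (hp m) x hx0 (h2.trans (min_le_left _ _))) ?_
      have h3 : f (m + 1) ‖x‖ ≤ ∑' n, f n ‖x‖ :=
        (hfs ‖x‖).le_tsum (m + 1) (fun j _ => hf0 j _)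
      have h4 : f (m + 1) ‖x‖ = (1 / 2 : ℝ) ^ m := by
        have : 1 ≤ |‖x‖| / D (m + 1) := by
          rw [le_div_iff₀ (hDpos _), abs_of_pos hx0]; linarith
        simp only [hf]
        rw [min_eq_left this]
        ring
      show (1 / 2 : ℝ) ^ m ≤ ‖x‖ + ∑' n, f n ‖x‖
      linarith
  · rintro ⟨δ₀, hδ₀, γ, hc, -, h0, -, hS⟩ ε hε
    obtain ⟨η, hη, hηε⟩ := Metric.continuousWithinAt_iff.mp (hc 0 Set.self_mem_Ici) ε hε
    refine ⟨min δ₀ (η / 2), lt_min hδ₀ (by linarith), fun x hx0 hx => ?_⟩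
    refine hmono x _ _ (hS x hx0 (hx.trans (min_le_left _ _))) ?_
    have hx2 := hx.trans (min_le_right _ _)
    have := hηε (x := ‖x‖) (norm_nonneg x) (by
      rw [Real.dist_eq, sub_zero, abs_of_pos hx0]; linarith)
    rw [h0, Real.dist_eq, sub_zero] at this
    exact (le_abs_self _).trans this.le
end
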